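/- Let T be a finite tree. For any two distinct vertices u, v of T, the Jordan centralities satisfy ψ_T(u) ≤ ψ_T(v) if and only if |(T,v)_{u↓}| ≥ |(T,u)_{v↓}|. -/

import Mathlib

open SimpleGraph Finset

variable {V : Type*} [Fintype V] [DecidableEq V]

/-- `(T,v)_{u↓}`: the set of vertices `w` whose unique path to `v` passes through `u`. -/
def subtreeSet (T : SimpleGraph V) (v u : V) : Set V :=
  {w | ∀ p : T.Path w v, u ∈ p.1.support}

/-- `|(T,v)_{u↓}|` -/
noncomputable def subtreeCard (T : SimpleGraph V) (v u : V) : ℕ :=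
  Nat.card (subtreeSet T v u)

/-- Jordan centrality `ψ_T(v) = max_{u ≠ v} |(T,v)_{u↓}|`; smaller is more central. -/
noncomputable def jordan (T : SimpleGraph V) (v : V) : ℕ :=
  (Finset.univ.erase v).sup fun u => subtreeCard T v u

theorem mem_subtreeSet_iff {T : SimpleGraph V} {v u w : V} :
    w ∈ subtreeSet T v u ↔ ∀ p : T.Walk w v, u ∈ p.support :=
  ⟨fun h p => p.support_bypass_subset_support (h p.toPath), fun h p => h p.1⟩

theorem notMem_subtreeSet_iff {T : SimpleGraph V} {v u w : V} :
    w ∉ subtreeSet T v u ↔ ∃ p : T.Walk w v, u ∉ p.support := by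
  rw [mem_subtreeSet_iff, not_forall]

/-- Every vertex of a branch below `x` reaches `x` without meeting the root `u`. -/
theorem exists_walk_avoiding_root {T : SimpleGraph V} (hT : T.Connected) {u x w : V}
    (hx : x ≠ u) (hw : w ∈ subtreeSet T u x) : ∃ p : T.Walk w x, u ∉ p.support := by
  obtain ⟨p, hp⟩ := (hT w u).exists_isPath
  exact ⟨p.takeUntil x (hw ⟨p, hp⟩), Walk.endpoint_notMem_support_takeUntil hp _ hx.symm⟩

theorem self_notMem_subtreeSet {T : SimpleGraph V} {u x : V} (hx : x ≠ u) :
    u ∉ subtreeSet T u x :=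
  notMem_subtreeSet_iff.2 ⟨Walk.nil, by simpa using hx⟩

theorem self_mem_subtreeSet {T : SimpleGraph V} (v u : V) : u ∈ subtreeSet T v u :=
  fun p => p.1.start_mem_support

theorem subtreeSet_subset_compl {T : SimpleGraph V} (hT : T.Connected) {u v x : V}
    (hx : x ≠ u) (hxv : x ∉ subtreeSet T v u) :
    subtreeSet T u x ⊆ (subtreeSet T v u)ᶜ := by
  intro w hw
  obtain ⟨p, hp⟩ := exists_walk_avoiding_root hT hx hw
  obtain ⟨q, hq⟩ := notMem_subtreeSet_iff.1 hxv
  exact notMem_subtreeSet_iff.2 ⟨p.append q, by simp [Walk.mem_support_append_iff, hp, hq]⟩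

theorem subtreeSet_ssubset {T : SimpleGraph V} (hT : T.Connected) {u v x : V}
    (hx : x ≠ u) (hxv : x ∈ subtreeSet T v u) :
    subtreeSet T u x ⊂ subtreeSet T v u := by
  refine ⟨fun w hw => ?_, fun h => self_notMem_subtreeSet hx (h (self_mem_subtreeSet v u))⟩
  obtain ⟨p, hp⟩ := exists_walk_avoiding_root hT hx hw
  by_contra hwv
  obtain ⟨q, hq⟩ := notMem_subtreeSet_iff.1 hwv
  have := mem_subtreeSet_iff.1 hxv (p.reverse.append q)
  simp [Walk.mem_support_append_iff, hp, hq] at this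

theorem exists_compl_subtreeSet_subset {T : SimpleGraph V} (hT : T.IsTree) {u v : V}
    (huv : u ≠ v) : ∃ x ≠ u, (subtreeSet T v u)ᶜ ⊆ subtreeSet T u x := by
  obtain ⟨p, hp⟩ := (hT.connected u v).exists_isPath
  cases p with
  | nil => exact absurd rfl huv
  | @cons _ x _ h q =>
    refine ⟨x, h.ne', fun w hw r => ?_⟩
    obtain ⟨p, hp'⟩ := notMem_subtreeSet_iff.1 hw
    have hq : u ∉ q.support := ((Walk.cons_isPath_iff h q).1 hp).2
    have hs : u ∉ (p.append q.reverse).bypass.support := fun hu => by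
      have := Walk.support_bypass_subset_support _ hu
      simp [Walk.mem_support_append_iff, hp', hq] at this
    have hc := (Walk.bypass_isPath (p.append q.reverse)).concat hs h.symm
    rw [(hT.isAcyclic.subsingleton_path w u).elim r ⟨_, hc⟩]
    simp [Walk.support_concat]

theorem card_compl_subtreeSet (T : SimpleGraph V) (v u : V) :
    Nat.card ↥(subtreeSet T v u)ᶜ + subtreeCard T v u = Fintype.card V := by
  rw [← Nat.card_eq_fintype_card, subtreeCard, add_comm]
  exact Set.ncard_add_ncard_compl (subtreeSet T v u)

theorem card_le_jordan_add_subtreeCard {T : SimpleGraph V} (hT : T.IsTree) {u v : V}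
    (huv : u ≠ v) : Fintype.card V ≤ jordan T u + subtreeCard T v u := by
  obtain ⟨x, hx, hsub⟩ := exists_compl_subtreeSet_subset hT huv
  have h₁ : subtreeCard T u x ≤ jordan T u :=
    Finset.le_sup (f := fun x => subtreeCard T u x) (by simpa using hx)
  have h₂ : Nat.card ↥(subtreeSet T v u)ᶜ ≤ subtreeCard T u x :=
    Nat.card_mono (Set.toFinite _) hsub
  have := card_compl_subtreeSet T v u
  omega

theorem jordan_le_max {T : SimpleGraph V} (hT : T.Connected) (u v : V) :
    jordan T u ≤ max (subtreeCard T v u - 1) (Fintype.card V - subtreeCard T v u) := by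
  refine Finset.sup_le fun x hx => ?_
  have hx : x ≠ u := Finset.ne_of_mem_erase hx
  by_cases hxv : x ∈ subtreeSet T v u
  · have : subtreeCard T u x < subtreeCard T v u :=
      Set.ncard_lt_ncard (subtreeSet_ssubset hT hx hxv)
    omega
  · have : subtreeCard T u x ≤ Nat.card ↥(subtreeSet T v u)ᶜ :=
      Nat.card_mono (Set.toFinite _) (subtreeSet_subset_compl hT hx hxv)
    have := card_compl_subtreeSet T v u
    omega

theorem subtreeCard_add_le_card {T : SimpleGraph V} (hT : T.Connected) {u v : V}
    (huv : u ≠ v) : subtreeCard T u v + subtreeCard T v u ≤ Fintype.card V := by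
  have : subtreeCard T u v ≤ Nat.card ↥(subtreeSet T v u)ᶜ :=
    Nat.card_mono (Set.toFinite _)
      (subtreeSet_subset_compl hT huv.symm (self_notMem_subtreeSet huv))
  have := card_compl_subtreeSet T v u
  omega

theorem subtreeCard_pos (T : SimpleGraph V) (v u : V) : 0 < subtreeCard T v u :=
  (Set.ncard_pos (Set.toFinite _)).2 ⟨u, self_mem_subtreeSet v u⟩

/-- For a finite tree `T` and distinct vertices `u, v`:
`ψ_T(u) ≤ ψ_T(v) ↔ |(T,v)_{u↓}| ≥ |(T,u)_{v↓}|`. -/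
theorem jordan_le_iff (T : SimpleGraph V) (hT : T.IsTree) (u v : V) (huv : u ≠ v) :
    jordan T u ≤ jordan T v ↔ subtreeCard T u v ≤ subtreeCard T v u := by
  have h₁ := card_le_jordan_add_subtreeCard hT huv
  have h₂ := card_le_jordan_add_subtreeCard hT huv.symm
  have h₃ := jordan_le_max hT.connected u v
  have h₄ := jordan_le_max hT.connected v u
  have h₅ := subtreeCard_add_le_card hT.connected huv
  have h₆ := subtreeCard_pos T u v
  omega
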